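/- Let N ≥ 1, let T ≥ 1 be an integer, let Ω ⊆ ℤ/Nℤ be nonempty, and let K(t) = ∑_{ω∈Ω} e^{2πiωt/N}, so K(0) = |Ω|. Assume |K(t)| < K(0)/(2T) for every t ≠ 0. Let S ⊆ ℤ/Nℤ with |S| ≤ T and let (λ_{t'})_{t'∈S} be complex numbers of modulus 1. Then the function P(t) = ∑_{t'∈S} λ_{t'}·K(t − t')/K(0) satisfies: (i) its Fourier transform P̂ is supported in Ω; (ii) |P(t) − λ_t| < 1/2 for every t ∈ S; and (iii) |P(t)| < 1/2 for every t ∉ S. -/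

import Mathlib

/-- Discrete Fourier transform on `ℤ/Nℤ`:
`P̂(ω) = ∑_{t ∈ ℤ/Nℤ} P(t) · e^{-2πiωt/N}`. -/
noncomputable def dft {N : ℕ} [NeZero N] (P : ZMod N → ℂ) (ω : ZMod N) : ℂ :=
  ∑ t : ZMod N,
    P t * Complex.exp (-(2 * Real.pi * Complex.I * (ω.val * t.val)) / N)

theorem stdAddChar_mul_eq_exp {N : ℕ} [NeZero N] (ω t : ZMod N) :
    ZMod.stdAddChar (ω * t) =
      Complex.exp (2 * Real.pi * Complex.I * (ω.val * t.val) / N) := by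
  have h := ZMod.stdAddChar_coe (N := N) ((ω.val : ℤ) * (t.val : ℤ))
  simpa using h

theorem dft_eq_sum_stdAddChar {N : ℕ} [NeZero N] (P : ZMod N → ℂ) (ω : ZMod N) :
    dft P ω = ∑ t : ZMod N, P t * ZMod.stdAddChar (-(ω * t)) := by
  refine Finset.sum_congr rfl fun t _ => ?_
  rw [AddChar.map_neg_eq_inv, stdAddChar_mul_eq_exp, ← Complex.exp_neg, neg_div]

/-- A translate of an idempotent kernel has no Fourier mass outside the spectrum of the kernel. -/
theorem dft_translate_sum_stdAddChar_eq_zero {N : ℕ} [NeZero N] (Ω : Finset (ZMod N))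
    (s : ZMod N) {ω : ZMod N} (hω : ω ∉ Ω) :
    dft (fun t => ∑ η ∈ Ω, ZMod.stdAddChar (η * (t - s))) ω = 0 := by
  simp only [dft_eq_sum_stdAddChar, Finset.sum_mul]
  rw [Finset.sum_comm]
  refine Finset.sum_eq_zero fun η hη => ?_
  have hne : η - ω ≠ 0 := sub_ne_zero.mpr fun h => hω (h ▸ hη)
  have hsum := AddChar.sum_mulShift (η - ω) (ZMod.isPrimitive_stdAddChar N)
  rw [if_neg hne] at hsum
  calc ∑ t : ZMod N, ZMod.stdAddChar (η * (t - s)) * ZMod.stdAddChar (-(ω * t))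
      = ∑ t : ZMod N, ZMod.stdAddChar (-(η * s)) * ZMod.stdAddChar (t * (η - ω)) := by
        refine Finset.sum_congr rfl fun t _ => ?_
        rw [← AddChar.map_add_eq_mul, ← AddChar.map_add_eq_mul]
        congr 1
        ring
    _ = 0 := by rw [← Finset.mul_sum, hsum]; simp

theorem dft_sum_const_mul {N : ℕ} [NeZero N] {ι : Type*} (S : Finset ι) (c : ι → ℂ)
    (f : ι → ZMod N → ℂ) (ω : ZMod N) :
    dft (fun t => ∑ s ∈ S, c s * f s t) ω = ∑ s ∈ S, c s * dft (f s) ω := by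
  simp only [dft, Finset.sum_mul, Finset.mul_sum]
  rw [Finset.sum_comm]
  simp only [mul_assoc]

/-- A sum of at most `T` terms, each of norm less than `1 / (2 * T)`, has norm less than `1 / 2`. -/
theorem norm_sum_lt_half {ι E : Type*} [SeminormedAddCommGroup E] {T : ℕ} (hT : 1 ≤ T)
    (A : Finset ι) (hA : A.card ≤ T) (f : ι → E) (hf : ∀ i ∈ A, ‖f i‖ < 1 / (2 * (T : ℝ))) :
    ‖∑ i ∈ A, f i‖ < 1 / 2 := by
  rcases A.eq_empty_or_nonempty with rfl | hne
  · simp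
  have hT' : (0 : ℝ) < T := by exact_mod_cast hT
  have hA' : (A.card : ℝ) ≤ T := by exact_mod_cast hA
  calc ‖∑ i ∈ A, f i‖ ≤ ∑ i ∈ A, ‖f i‖ := norm_sum_le _ _
    _ < ∑ _i ∈ A, 1 / (2 * (T : ℝ)) := Finset.sum_lt_sum_of_nonempty hne hf
    _ = A.card * (1 / (2 * (T : ℝ))) := by rw [Finset.sum_const, nsmul_eq_mul]
    _ ≤ T * (1 / (2 * (T : ℝ))) := by gcongr
    _ = 1 / 2 := by field_simp

/-- Construction of the dual certificate: if the idempotent kernel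
`K(t) = ∑_{ω∈Ω} e^{2πiωt/N}` satisfies `|K(t)| < K(0)/(2T)` for `t ≠ 0`, `|S| ≤ T`,
and `(λ_{t'})_{t'∈S}` are unimodular, then `P(t) = ∑_{t'∈S} λ_{t'}·K(t−t')/K(0)`
has Fourier transform supported in `Ω`, satisfies `|P(t) − λ_t| < 1/2` on `S`
and `|P(t)| < 1/2` off `S`. -/
theorem stmt_15 (N : ℕ) [NeZero N] (hN : 1 ≤ N) (T : ℕ) (hT : 1 ≤ T)
    (Ω : Finset (ZMod N)) (hΩ : Ω.Nonempty)
    (K : ZMod N → ℂ)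
    (hKdef : ∀ t : ZMod N,
      K t = ∑ ω ∈ Ω, Complex.exp (2 * Real.pi * Complex.I * (ω.val * t.val) / N))
    (hK : ∀ t : ZMod N, t ≠ 0 → ‖K t‖ < (Ω.card : ℝ) / (2 * T))
    (S : Finset (ZMod N)) (hS : S.card ≤ T)
    (lam : ZMod N → ℂ) (hlam : ∀ t' ∈ S, ‖lam t'‖ = 1)
    (P : ZMod N → ℂ) (hPdef : ∀ t, P t = ∑ t' ∈ S, lam t' * K (t - t') / K 0) :
    (∀ ω ∉ Ω, dft P ω = 0) ∧
    (∀ t ∈ S, ‖P t - lam t‖ < 1 / 2) ∧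
    (∀ t ∉ S, ‖P t‖ < 1 / 2) := by
  have hK0 : K 0 = Ω.card := by simp [hKdef]
  have hcard : (0 : ℝ) < Ω.card := by exact_mod_cast hΩ.card_pos
  have hK0ne : K 0 ≠ 0 := by
    rw [hK0]
    exact_mod_cast hΩ.card_pos.ne'
  have hterm : ∀ t, ∀ s ∈ S, s ≠ t → ‖lam s * K (t - s) / K 0‖ < 1 / (2 * (T : ℝ)) := by
    intro t s hs hst
    rw [norm_div, norm_mul, hlam s hs, one_mul, hK0, Complex.norm_natCast, div_lt_iff₀ hcard,
      div_mul_eq_mul_div, one_mul]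
    exact hK _ (sub_ne_zero.mpr hst.symm)
  refine ⟨fun ω hω => ?_, fun t ht => ?_, fun t ht => ?_⟩
  · have hP : P = fun t => ∑ s ∈ S, lam s / K 0 *
        ∑ η ∈ Ω, ZMod.stdAddChar (η * (t - s)) := by
      funext t
      rw [hPdef]
      refine Finset.sum_congr rfl fun s _ => ?_
      rw [mul_div_right_comm, hKdef (t - s)]
      simp only [stdAddChar_mul_eq_exp]
    rw [hP, dft_sum_const_mul S (fun s => lam s / K 0)
      (fun s t => ∑ η ∈ Ω, ZMod.stdAddChar (η * (t - s)))]
    exact Finset.sum_eq_zero fun s _ => by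
      rw [dft_translate_sum_stdAddChar_eq_zero Ω s hω, mul_zero]
  · have hsplit : P t - lam t = ∑ s ∈ S.erase t, lam s * K (t - s) / K 0 := by
      rw [hPdef, ← Finset.add_sum_erase S _ ht, sub_self, mul_div_cancel_right₀ _ hK0ne,
        add_sub_cancel_left]
    rw [hsplit]
    exact norm_sum_lt_half hT _ ((Finset.card_erase_le).trans hS) _ fun s hs =>
      hterm t s (Finset.mem_of_mem_erase hs) (Finset.ne_of_mem_erase hs)
  · rw [hPdef]
    exact norm_sum_lt_half hT _ hS _ fun s hs => hterm t s hs fun h => ht (h ▸ hs)
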